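/- arXiv:1701.02420 — 2 statements merged into one kernel-verified Lean document; each statement's English description precedes it below -/
import Mathlib

section
/- If p ∈ ℝ[x] is a polynomial of odd degree, then the sequence (p(k))_{k≥0} is not a multiplier sequence for the Legendre basis. -/
open Polynomial Finset

/-- The `k`-th Legendre polynomial, via Rodrigues' formula. -/
noncomputable def legendreP (k : ℕ) : Polynomial ℝ :=
  (1 / (2 ^ k * (Nat.factorial k) : ℝ)) • (Polynomial.derivative^[k] ((X ^ 2 - 1) ^ k))

/-- A real polynomial is hyperbolic if it is zero or all of its complex roots are real. -/
def Hyperbolic (p : Polynomial ℝ) : Prop :=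
  p = 0 ∨ ∀ z : ℂ, Polynomial.aeval z p = 0 → z.im = 0

/-- `γ` is a multiplier sequence for the Legendre basis: the (unique) linear operator `T`
on `ℝ[x]` with `T P_k = γ_k P_k` preserves hyperbolicity. -/
def IsLegendreMS (γ : ℕ → ℝ) : Prop :=
  ∀ T : Polynomial ℝ →ₗ[ℝ] Polynomial ℝ,
    (∀ k : ℕ, T (legendreP k) = γ k • legendreP k) →
    ∀ p : Polynomial ℝ, Hyperbolic p → Hyperbolic (T p)

/-! ### Part 1 : real-rooted polynomials -/

theorem hyp_splits {p : Polynomial ℝ} (h : Hyperbolic p) : p.Splits := by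
  rcases h with h | h
  · rw [h]; exact Splits.zero
  · refine Splits.of_splits_map (algebraMap ℝ ℂ) (IsAlgClosed.splits _) ?_
    intro a ha
    have h0 := (mem_roots'.1 ha).2
    rw [IsRoot.def, eval_map_algebraMap] at h0
    have := h a h0
    exact ⟨a.re, by apply Complex.ext <;> simp [this]⟩

theorem splits_hyp {p : Polynomial ℝ} (h : p.Splits) : Hyperbolic p := by
  by_cases h0 : p = 0
  · exact Or.inl h0
  right
  intro z hz
  obtain ⟨a, rfl⟩ := h.mem_range_of_isRoot h0 (i := algebraMap ℝ ℂ) (x := z)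
    (by rw [IsRoot.def, eval_map_algebraMap]; exact hz)
  simp

theorem splits_derivative {p : Polynomial ℝ} (h : p.Splits) : (derivative p).Splits := by
  by_cases h0 : p.natDegree = 0
  · rw [natDegree_eq_zero] at h0
    obtain ⟨a, rfl⟩ := h0
    rw [derivative_C]; exact Splits.zero
  rw [splits_iff_card_roots] at *
  have h1 := card_roots_le_derivative p
  have h2 := card_roots' (derivative p)
  have h3 := natDegree_derivative_lt h0
  omega

theorem splits_laguerre {p : Polynomial ℝ} (h : p.Splits) (x : ℝ) :
    p.eval x * (derivative (derivative p)).eval x ≤ (derivative p).eval x ^ 2 := by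
  unfold Splits at h
  induction h using Submonoid.closure_induction_left with
  | one => simp
  | mul_left a ha y hy ih =>
    rcases ha with ⟨c, rfl⟩ | ⟨c, rfl⟩
    · simp only [derivative_C_mul, eval_mul, eval_C]
      nlinarith [mul_nonneg (sq_nonneg c) (sub_nonneg.2 ih)]
    · simp only [derivative_mul, derivative_add, derivative_X, derivative_C, add_zero, one_mul,
        eval_mul, eval_add, eval_X, eval_C]
      nlinarith [mul_nonneg (sq_nonneg (x + c)) (sub_nonneg.2 ih), sq_nonneg (y.eval x)]

theorem splits_newton {p : Polynomial ℝ} (h : p.Splits) (j : ℕ) :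
    ((j.factorial : ℝ) * p.coeff j) * (((j+2).factorial : ℝ) * p.coeff (j+2))
      ≤ (((j+1).factorial : ℝ) * p.coeff (j+1)) ^ 2 := by
  have key : ∀ i, (derivative^[i] p).Splits := by
    intro i
    induction i with
    | zero => exact h
    | succ i ih => rw [Function.iterate_succ_apply']; exact splits_derivative ih
  have := splits_laguerre (key j) 0
  rw [← Function.iterate_succ_apply' derivative, ← Function.iterate_succ_apply' derivative] at this
  have hc : ∀ i, (derivative^[i] p).eval 0 = (i.factorial : ℝ) * p.coeff i := by
    intro i
    rw [← coeff_zero_eq_eval_zero, coeff_iterate_derivative]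
    simp [Nat.descFactorial_self]
  rw [hc, hc, hc] at this
  exact this

/-! ### Part 2 : the operators -/

/-- The Legendre operator in the shifted variable. -/
noncomputable def opL : Polynomial ℝ →ₗ[ℝ] Polynomial ℝ :=
  derivative ∘ₗ (LinearMap.mulLeft ℝ (X * (1 + X))) ∘ₗ derivative

theorem opL_apply (f : Polynomial ℝ) : opL f = derivative (X * (1 + X) * derivative f) := rfl

theorem opL_coeff (f : Polynomial ℝ) (j : ℕ) :
    (opL f).coeff j = j * (j+1) * f.coeff j + (j+1)^2 * f.coeff (j+1) := by
  have h : X * (1 + X) * derivative f = derivative f * X + derivative f * X ^ 2 := by ring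
  rw [opL_apply, coeff_derivative, h, coeff_add, coeff_mul_X, coeff_derivative]
  rcases j with _ | j
  · simp [coeff_mul_X_pow']
  · rw [show j + 1 + 1 = j + 2 from rfl, coeff_mul_X_pow, coeff_derivative]
    push_cast; ring

noncomputable def cc : ℕ → ℝ
  | 0 => 1
  | n+1 => cc n * ((n+1) / (n+1/2))

noncomputable def rf : ℕ → ℝ
  | 0 => 1
  | n+1 => rf n * (n+3/2)

theorem cc_pos (n : ℕ) : 0 < cc n := by
  induction n with
  | zero => simp [cc]
  | succ n ih => rw [cc]; positivity

theorem rf_pos (n : ℕ) : 0 < rf n := by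
  induction n with
  | zero => simp [rf]
  | succ n ih => rw [rf]; positivity

theorem cc_sq (n : ℕ) : (n + 1 : ℝ) ≤ cc n ^ 2 := by
  induction n with
  | zero => simp [cc]
  | succ n ih =>
    rw [cc, mul_pow, div_pow, ← mul_div_assoc, le_div_iff₀ (by positivity)]
    push_cast
    have hn : (0:ℝ) ≤ n := Nat.cast_nonneg n
    have := mul_le_mul_of_nonneg_right ih (sq_nonneg (n+1:ℝ))
    nlinarith

theorem cc_tendsto : Filter.Tendsto cc Filter.atTop Filter.atTop := by
  rw [Filter.tendsto_atTop]
  intro b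
  obtain ⟨N, hN⟩ := exists_nat_ge (b^2)
  filter_upwards [Filter.eventually_ge_atTop N] with n hn
  have h1 := cc_sq n
  have h2 : (N:ℝ) ≤ n := by exact_mod_cast hn
  exact le_of_sq_le_sq' h1 h2 hN (cc_pos n)
where
  le_of_sq_le_sq' {b c : ℝ} {n N : ℕ} (h1 : (n + 1 : ℝ) ≤ c ^ 2) (h2 : (N:ℝ) ≤ n)
      (hN : b^2 ≤ N) (hc : 0 < c) : b ≤ c := by
    apply le_of_not_gt
    intro h
    nlinarith

theorem cc_rf (n : ℕ) : cc n * rf n = (2*n+1) * n.factorial := by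
  induction n with
  | zero => simp [cc, rf]
  | succ n ih =>
    rw [cc, rf, Nat.factorial_succ]
    have : (n + 1/2 : ℝ) ≠ 0 := by positivity
    have e : cc n * ((n+1) / (n+1/2)) * (rf n * (n+3/2))
      = (cc n * rf n) * ((n+1) * (n+3/2) / (n+1/2)) := by ring
    rw [e, ih]
    push_cast
    field_simp
    ring

noncomputable def gg (n j : ℕ) : ℝ := cc n * rf j * n.descFactorial j / (j.factorial : ℝ)^2

noncomputable def opG (n : ℕ) : Polynomial ℝ :=
  ∑ j ∈ range (n+1), monomial j (gg n j)

theorem gg_zero {n j : ℕ} (h : n < j) : gg n j = 0 := by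
  simp [gg, Nat.descFactorial_of_lt h]

theorem opG_coeff (n j : ℕ) : (opG n).coeff j = gg n j := by
  rw [opG, finsetSum_coeff]
  simp only [coeff_monomial]
  rw [Finset.sum_ite_eq' (range (n+1)) j]
  split_ifs with h
  · rfl
  · rw [gg_zero]; simpa using h

theorem descF_succ (n j : ℕ) :
    ((n.descFactorial (j+1) : ℕ) : ℝ) = ((n:ℝ) - j) * n.descFactorial j := by
  rw [Nat.descFactorial_succ]
  rcases le_or_gt j n with h | h
  · rw [Nat.cast_mul, Nat.cast_sub h]
  · rw [Nat.descFactorial_of_lt h]; simp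

theorem gg_succ_right (n j : ℕ) : (j+1:ℝ)^2 * gg n (j+1) = (j + 3/2) * (n - j) * gg n j := by
  have : (j.factorial : ℝ) ≠ 0 := by positivity
  rw [gg, gg, descF_succ, rf, Nat.factorial_succ]
  push_cast
  field_simp

theorem gg_succ_left (n j : ℕ) : (n+1:ℝ)^2 * gg n j = (n + 1/2) * (n + 1 - j) * gg (n+1) j := by
  have h1 : (j.factorial : ℝ) ≠ 0 := by positivity
  have h2 : (n + 1/2 : ℝ) ≠ 0 := by positivity
  have h3 : (n + 1 : ℝ) * n.descFactorial j = (n + 1 - j) * (n+1).descFactorial j := by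
    have a := descF_succ (n+1) j
    rw [Nat.succ_descFactorial_succ] at a
    push_cast at a
    exact a
  rw [gg, gg, cc]
  have e : (n + 1/2 : ℝ) * (n + 1 - j) * (cc n * ((n + 1) / (n + 1/2)) * rf j *
      (n+1).descFactorial j / (j.factorial : ℝ)^2) = cc n * rf j / (j.factorial : ℝ)^2 * (n+1) *
        ((n + 1 - j) * (n+1).descFactorial j) := by
    field_simp
  rw [e, ← h3]
  ring

theorem opL_opG (n : ℕ) :
    opL (opG n) = (n * (n+1) : ℝ) • opG n - ((n : ℝ)^2) • opG (n-1) := by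
  ext j
  rw [opL_coeff, coeff_sub, coeff_smul, coeff_smul, opG_coeff, opG_coeff, opG_coeff,
    gg_succ_right]
  rcases n with _ | n
  · rcases j with _ | j
    · simp
    · simp [gg_zero]
  · have := gg_succ_left n j
    simp only [smul_eq_mul, Nat.add_sub_cancel]
    push_cast
    rw [this]
    ring

/-- `X ^ n ↦ opG n`. -/
noncomputable def opS' : Polynomial ℝ →ₗ[ℝ] Polynomial ℝ :=
  (Polynomial.basisMonomials ℝ).constr ℝ opG

theorem opS'_monomial (n : ℕ) (a : ℝ) : opS' (monomial n a) = a • opG n := by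
  have h : opS' (monomial n 1) = opG n := by
    have := (Polynomial.basisMonomials ℝ).constr_basis ℝ opG n
    rwa [coe_basisMonomials] at this
  rw [← h, ← map_smul, smul_monomial]; simp

noncomputable def opS : Polynomial ℝ →ₗ[ℝ] Polynomial ℝ := opS' ∘ₗ taylor (-1)

theorem opS_pow (n : ℕ) : opS ((1 + X)^n) = opG n := by
  have : taylor (-1:ℝ) ((1 + X)^n) = monomial n 1 := by
    rw [taylor_apply, pow_comp, ← X_pow_eq_monomial]; simp
  rw [opS, LinearMap.comp_apply, this, opS'_monomial, one_smul]

theorem opS_opL (f : Polynomial ℝ) : opS (opL f) = opL (opS f) := by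
  have h1 : taylor (-1:ℝ) (opL f) =
      derivative ((X ^ 2 - X) * derivative (taylor (-1:ℝ) f)) := by
    rw [opL_apply]
    simp only [taylor_apply, derivative_comp]
    simp [derivative_comp]
    ring
  have h2 : ∀ g : Polynomial ℝ, opS' (derivative ((X ^ 2 - X) * derivative g)) = opL (opS' g) := by
    intro g
    induction g using Polynomial.induction_on' with
    | add p q hp hq => simp only [mul_add, map_add, hp, hq]
    | monomial n a =>
      have : derivative ((X ^ 2 - X) * derivative (monomial n a))
          = monomial n (a * (n * (n+1))) - monomial (n-1) (a * (n:ℝ)^2) := by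
        rcases n with _ | n
        · simp
        · rw [derivative_monomial]
          simp only [← C_mul_X_pow_eq_monomial, Nat.add_sub_cancel]
          have : (X^2 - X) * (C (a * ((n+1 : ℕ):ℝ)) * X^n)
            = C (a * ((n+1 : ℕ):ℝ)) * X^(n+2) - C (a * ((n+1 : ℕ):ℝ)) * X^(n+1) := by ring
          rw [this, derivative_sub, derivative_C_mul_X_pow, derivative_C_mul_X_pow]
          push_cast
          congr 1
          · congr 2; ring
          · congr 2; ring
      rw [this, map_sub, opS'_monomial, opS'_monomial, opS'_monomial, map_smul, opL_opG, smul_sub,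
        smul_smul, smul_smul]
  rw [opS, LinearMap.comp_apply, h1, h2]; rfl

/-! ### Part 3 : eigenvectors -/

noncomputable def ee (k : ℕ) : Polynomial ℝ :=
  (1 / (k.factorial : ℝ)) • derivative^[k] (X ^ k * (1 + X) ^ k)

theorem ee_coeff (k j : ℕ) : (ee k).coeff j = ((k + j).choose k : ℝ) * k.choose j := by
  have h : (X ^ k * (1 + X) ^ k : Polynomial ℝ).coeff (j + k) = k.choose j := by
    rw [coeff_X_pow_mul, coeff_one_add_X_pow]
  have hk : (k.factorial : ℝ) ≠ 0 := by positivity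
  rw [ee, coeff_smul, coeff_iterate_derivative, h, Nat.descFactorial_eq_factorial_mul_choose,
    add_comm j k]
  simp only [smul_eq_mul, nsmul_eq_mul]
  push_cast
  field_simp

theorem ee_succ (k j : ℕ) :
    (j+1:ℝ)^2 * (ee k).coeff (j+1) = (k - j) * (k + j + 1) * (ee k).coeff j := by
  rw [ee_coeff, ee_coeff]
  have h1 : (k.choose (j+1) : ℝ) * (j+1) = k.choose j * (k - j) := by
    rcases le_or_gt j k with h | h
    · have := Nat.choose_succ_right_eq k j
      rw [← Nat.cast_sub h]
      exact_mod_cast this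
    · rw [Nat.choose_eq_zero_of_lt h, Nat.choose_eq_zero_of_lt (by omega)]; simp
  have h2 : ((k+(j+1)).choose k : ℝ) * (j+1) = (k + j + 1) * (k+j).choose k := by
    have := Nat.add_one_mul_choose_eq (k+j) j
    rw [Nat.choose_symm_add, Nat.choose_symm_add]
    have h3 : ((k + j + 1 : ℕ) : ℝ) * ((k+j).choose j : ℕ) = ((k+j+1).choose (j+1) : ℕ) * ((j + 1 : ℕ):ℝ) := by
      exact_mod_cast this
    push_cast at h3
    rw [h3]; rfl
  calc (j+1:ℝ)^2 * (((k+(j+1)).choose k : ℝ) * k.choose (j+1))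
      = (((k+(j+1)).choose k : ℝ) * (j+1)) * ((k.choose (j+1) : ℝ) * (j+1)) := by ring
    _ = _ := by rw [h1, h2]; ring

theorem opL_ee (k : ℕ) : opL (ee k) = (k * (k+1) : ℝ) • ee k := by
  ext j
  rw [opL_coeff, ee_succ, coeff_smul, smul_eq_mul]
  ring

theorem eig_unique (k : ℕ) (v : Polynomial ℝ) (hv : opL v = (k * (k+1) : ℝ) • v) :
    v = v.coeff 0 • ee k := by
  ext j
  induction j with
  | zero => rw [coeff_smul, ee_coeff]; simp
  | succ j ih =>
    have h := congrArg (fun q => coeff q j) hv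
    simp only [opL_coeff, coeff_smul, smul_eq_mul] at h
    rw [coeff_smul, smul_eq_mul] at ih ⊢
    have h2 := ee_succ k j
    have h3 : ((j:ℝ)+1)^2 ≠ 0 := by positivity
    apply mul_left_cancel₀ h3
    linear_combination h - v.coeff 0 * h2 + (k*(k+1) - j*(j+1)) * ih

theorem ee_natDegree_le (k : ℕ) : (ee k).natDegree ≤ k := by
  rw [natDegree_le_iff_coeff_eq_zero]
  intro N hN
  rw [ee_coeff, Nat.choose_eq_zero_of_lt hN]; simp

theorem opG_natDegree_le (k : ℕ) : (opG k).natDegree ≤ k := by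
  rw [natDegree_le_iff_coeff_eq_zero]
  intro N hN
  rw [opG_coeff, gg_zero hN]

theorem gg_diag (n : ℕ) : gg n n = 2*n+1 := by
  rw [gg, cc_rf, Nat.descFactorial_self]
  have : (n.factorial : ℝ) ≠ 0 := by positivity
  field_simp

theorem opS_coeff_top (k : ℕ) (f : Polynomial ℝ) (hf : f.natDegree ≤ k) :
    (opS f).coeff k = (2*k+1) * f.coeff k := by
  have h0 : (taylor (-1:ℝ) f).natDegree ≤ k := by rwa [natDegree_taylor]
  have h1 : (taylor (-1:ℝ) f).coeff k = f.coeff k := by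
    rcases hf.eq_or_lt with h | h
    · have := leadingCoeff_taylor (-1:ℝ) f
      rw [leadingCoeff, leadingCoeff, natDegree_taylor, h] at this
      exact this
    · rw [coeff_eq_zero_of_natDegree_lt h, coeff_eq_zero_of_natDegree_lt]
      rwa [natDegree_taylor]
  rw [opS, LinearMap.comp_apply, ← h1]
  generalize taylor (-1:ℝ) f = g at h0
  rw [g.as_sum_range_C_mul_X_pow' (Nat.lt_succ_of_le h0)]
  simp only [C_mul_X_pow_eq_monomial, map_sum, opS'_monomial, finsetSum_coeff, coeff_smul,
    opG_coeff, smul_eq_mul, coeff_monomial]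
  rw [Finset.sum_range_succ, Finset.sum_range_succ, Finset.sum_eq_zero, Finset.sum_eq_zero, gg_diag]
  · simp; ring
  · intro i hi
    rw [if_neg]; simp at hi; omega
  · intro i hi
    rw [gg_zero (by simpa using hi), mul_zero]

theorem opS_ee (k : ℕ) : opS (ee k) = (2*k+1 : ℝ) • ee k := by
  have h := eig_unique k (opS (ee k)) (by rw [← opS_opL, opL_ee, map_smul])
  have h2 := opS_coeff_top k (ee k) (ee_natDegree_le k)
  rw [h, coeff_smul, smul_eq_mul] at h2
  have h3 : (ee k).coeff k ≠ 0 := by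
    rw [ee_coeff]
    have : 0 < (k+k).choose k := Nat.choose_pos (by omega)
    simp; omega
  rw [mul_right_cancel₀ h3 h2] at h
  exact h

theorem aeval_opL_ee (q : Polynomial ℝ) (k : ℕ) :
    (aeval opL q) (ee k) = q.eval (k * (k+1) : ℝ) • ee k := by
  induction q using Polynomial.induction_on' with
  | add p q hp hq => simp only [map_add, LinearMap.add_apply, hp, hq, eval_add, add_smul]
  | monomial n a =>
    rw [aeval_monomial, eval_monomial]
    have : ∀ n : ℕ, (opL ^ n) (ee k) = ((k * (k+1) : ℝ)^n) • ee k := by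
      intro n
      induction n with
      | zero => simp
      | succ n ih => rw [pow_succ', Module.End.mul_apply, ih, map_smul, opL_ee, smul_smul, pow_succ]
    rw [Module.End.mul_apply, this, Module.algebraMap_end_apply, smul_smul]

/-- The operator in the shifted variable. -/
noncomputable def opT (q r : Polynomial ℝ) : Polynomial ℝ →ₗ[ℝ] Polynomial ℝ :=
  aeval opL q + aeval opL r ∘ₗ opS

theorem opT_ee (q r : Polynomial ℝ) (k : ℕ) :
    opT q r (ee k) = (q.eval (k * (k+1) : ℝ) + (2*k+1) * r.eval (k * (k+1) : ℝ)) • ee k := by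
  rw [opT, LinearMap.add_apply, LinearMap.comp_apply, opS_ee, map_smul, aeval_opL_ee, aeval_opL_ee,
    smul_smul, add_smul]

noncomputable def chA : Polynomial ℝ →ₐ[ℝ] Polynomial ℝ := aeval (C 2 * X + 1 : Polynomial ℝ)
noncomputable def chB : Polynomial ℝ →ₐ[ℝ] Polynomial ℝ := aeval (C (1/2) * (X - 1) : Polynomial ℝ)

theorem chBA (f : Polynomial ℝ) : chB (chA f) = f := by
  have : chB.comp chA = AlgHom.id ℝ _ := by
    ext1
    simp only [chA, chB, AlgHom.comp_apply, aeval_X, map_add, map_mul, map_one, AlgHom.id_apply]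
    rw [← algebraMap_eq, AlgHom.commutes, algebraMap_eq, ← mul_assoc, ← C_mul]
    norm_num
  exact congrArg (fun φ => φ f) this

theorem chA_legendre (k : ℕ) : chA (legendreP k) = ee k := by
  have h : ∀ (k : ℕ) (f : Polynomial ℝ),
      derivative^[k] (f.comp (C 2 * X + 1)) = C (2^k) * (derivative^[k] f).comp (C 2 * X + 1) := by
    intro k
    induction k with
    | zero => intro f; simp
    | succ k ih =>
      intro f
      rw [Function.iterate_succ_apply', Function.iterate_succ_apply', ih, derivative_C_mul,
        derivative_comp, pow_succ, C_mul]
      simp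
      ring
  have h4 : (X ^ 2 - 1 : Polynomial ℝ).comp (C 2 * X + 1) = C 4 * (X * (1 + X)) := by
    have : (C 4 : Polynomial ℝ) = C 2 * C 2 := by rw [← C_mul]; norm_num
    rw [this]
    have h2 : (C 2 : Polynomial ℝ) = 2 := rfl
    simp [h2]
    ring
  have h5 := h k ((X^2-1)^k)
  rw [pow_comp, h4, mul_pow, ← C_pow, iterate_derivative_C_mul] at h5
  have h6 : (derivative^[k] ((X^2-1 : Polynomial ℝ)^k)).comp (C 2 * X + 1)
      = C (2^k) * derivative^[k] (X ^ k * (1 + X)^k) := by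
    have h7 : (C (2^k) : Polynomial ℝ) ≠ 0 := by simp
    apply mul_left_cancel₀ h7
    rw [← h5, ← mul_assoc, ← C_mul, ← mul_pow, ← mul_pow]; norm_num
  rw [legendreP, map_smul, chA, ← comp_eq_aeval, h6, ee, ← smul_eq_C_mul, smul_smul]
  congr 1
  field_simp

noncomputable def opTx (q r : Polynomial ℝ) : Polynomial ℝ →ₗ[ℝ] Polynomial ℝ :=
  chB.toLinearMap ∘ₗ opT q r ∘ₗ chA.toLinearMap

theorem opTx_legendre (q r : Polynomial ℝ) (k : ℕ) :
    opTx q r (legendreP k) =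
      (q.eval (k * (k+1) : ℝ) + (2*k+1) * r.eval (k * (k+1) : ℝ)) • legendreP k := by
  simp only [opTx, LinearMap.comp_apply, AlgHom.toLinearMap_apply]
  rw [chA_legendre, opT_ee, map_smul, ← chA_legendre, chBA]

theorem decomp (m : ℕ) : ∀ p : Polynomial ℝ, p.natDegree ≤ 2*m+1 →
    ∃ q r : Polynomial ℝ, q.natDegree ≤ m ∧ r.natDegree ≤ m ∧ r.coeff m = p.coeff (2*m+1) / 2 ∧
      ∀ x : ℝ, p.eval x = q.eval (x * (x+1)) + (2*x+1) * r.eval (x*(x+1)) := by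
  induction m with
  | zero =>
    intro p hp
    refine ⟨C (p.coeff 0 - p.coeff 1 / 2), C (p.coeff 1 / 2), by simp, by simp, by simp, ?_⟩
    intro x
    rw [eval_eq_sum_range' (n := 2) (by omega)]
    simp [Finset.sum_range_succ]
    ring
  | succ m ih =>
    intro p hp
    have hm : (X ^ 2 + X : Polynomial ℝ).Monic := by monicity!
    have hd : (X ^ 2 + X : Polynomial ℝ).natDegree = 2 := by compute_degree!
    set p1 := p /ₘ (X^2 + X) with hp1
    set s := p %ₘ (X^2 + X) with hs
    have e : s + (X^2+X) * p1 = p := modByMonic_add_div p _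
    have hd1 : p1.natDegree ≤ 2*m+1 := by
      rw [hp1, natDegree_divByMonic _ hm, hd]; omega
    have hsd : s.natDegree < 2 := by
      rw [← hd]; exact natDegree_modByMonic_lt p hm (by intro h; rw [h] at hd; simp at hd)
    obtain ⟨q, r, hq, hr, hc, hx⟩ := ih p1 hd1
    refine ⟨X * q + C (s.coeff 0 - s.coeff 1 / 2), X * r + C (s.coeff 1 / 2), ?_, ?_, ?_, ?_⟩
    · rw [natDegree_add_C]
      exact natDegree_mul_le.trans (by rw [natDegree_X]; omega)
    · rw [natDegree_add_C]
      exact natDegree_mul_le.trans (by rw [natDegree_X]; omega)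
    · rw [coeff_add, coeff_X_mul, hc, coeff_C_succ, add_zero, ← e, coeff_add, add_mul, coeff_add,
        coeff_eq_zero_of_natDegree_lt (p := s) (by omega),
        show 2 * (m+1) + 1 = (2*m+1) + 2 by ring, coeff_X_pow_mul,
        show (2*m+1) + 2 = (2*m+2) + 1 by ring, coeff_X_mul,
        coeff_eq_zero_of_natDegree_lt (p := p1) (n := 2*m+2) (by omega)]
      simp
    · intro x
      conv_lhs => rw [← e]
      rw [eval_add, eval_mul, hx, eval_eq_sum_range' (p := s) hsd]
      simp [Finset.sum_range_succ]
      ring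

/-! ### Part 4 : asymptotics -/

/-- Scaled coefficientwise convergence. -/
def SC (f : ℕ → Polynomial ℝ) (κ : ℕ → ℝ) (l : ℕ → ℝ) : Prop :=
  ∀ j, Filter.Tendsto (fun n => (f n).coeff j / ((n:ℝ)^j * κ n)) Filter.atTop (nhds (l j))

theorem SC_opL {f : ℕ → Polynomial ℝ} {κ l : ℕ → ℝ} (h : SC f κ l) :
    SC (fun n => opL (f n)) (fun n => n * κ n) (fun j => (j+1)^2 * l (j+1)) := by
  intro j
  have h1 := (((h j).const_mul ((j:ℝ) * (j+1))).mul
    (tendsto_inv_atTop_nhds_zero_nat (𝕜 := ℝ))).add ((h (j+1)).const_mul (((j:ℝ)+1)^2))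
  rw [mul_zero, zero_add] at h1
  refine h1.congr ?_
  intro n
  rw [opL_coeff]
  simp only [div_eq_mul_inv, mul_inv, pow_succ]
  ring

theorem SC_opL_pow {f : ℕ → Polynomial ℝ} {κ l : ℕ → ℝ} (h : SC f κ l) (i : ℕ) :
    SC (fun n => (opL ^ i) (f n)) (fun n => (n:ℝ)^i * κ n)
      (fun j => (((j+i).factorial : ℝ) / j.factorial)^2 * l (j+i)) := by
  induction i with
  | zero =>
    intro j
    have : (j.factorial : ℝ) ≠ 0 := by positivity
    simpa [div_self this] using h j
  | succ i ih =>
    intro j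
    have h1 := SC_opL ih j
    have e : ((j:ℝ)+1)^2 * ((((j+1+i).factorial : ℝ) / (j+1).factorial)^2 * l (j+1+i))
        = (((j+(i+1)).factorial : ℝ) / j.factorial)^2 * l (j+(i+1)) := by
      rw [show j + 1 + i = j + (i+1) by ring, Nat.factorial_succ j]
      have : (j.factorial : ℝ) ≠ 0 := by positivity
      push_cast
      field_simp
    beta_reduce at h1 ⊢
    rw [e] at h1
    refine h1.congr ?_
    intro n
    simp only [pow_succ' opL, Module.End.mul_apply, pow_succ']
    rw [mul_assoc]

theorem SC_aeval {f : ℕ → Polynomial ℝ} {κ l : ℕ → ℝ} (h : SC f κ l) (r : Polynomial ℝ) (m : ℕ)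
    (hr : r.natDegree ≤ m) :
    SC (fun n => (aeval opL r) (f n)) (fun n => (n:ℝ)^m * κ n)
      (fun j => r.coeff m * ((((j+m).factorial : ℝ) / j.factorial)^2 * l (j+m))) := by
  intro j
  have h1 : ∀ n, ((aeval opL r) (f n)).coeff j / ((n:ℝ)^j * ((n:ℝ)^m * κ n))
      = ∑ i ∈ range (m+1), r.coeff i * (((opL ^ i) (f n)).coeff j / ((n:ℝ)^j * ((n:ℝ)^m * κ n))) := by
    intro n
    rw [aeval_eq_sum_range' (Nat.lt_succ_of_le hr), LinearMap.sum_apply, finsetSum_coeff,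
      Finset.sum_div]
    refine Finset.sum_congr rfl ?_
    intro i _
    rw [LinearMap.smul_apply, coeff_smul, smul_eq_mul, mul_div_assoc]
  simp only [h1]
  rw [show r.coeff m * ((((j+m).factorial : ℝ) / j.factorial)^2 * l (j+m))
    = ∑ i ∈ range (m+1), if i = m then
      r.coeff m * ((((j+m).factorial : ℝ) / j.factorial)^2 * l (j+m)) else 0 by
        rw [Finset.sum_ite_eq' (range (m+1)) m]; simp]
  refine tendsto_finsetSum _ ?_
  intro i hi
  split_ifs with him
  · subst him
    exact (SC_opL_pow h i j).const_mul _
  · have him' : i < m := by simp at hi; omega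
    obtain ⟨d, rfl⟩ : ∃ d, m = i + (d + 1) := ⟨m - i - 1, by omega⟩
    have h2 := ((SC_opL_pow h i j).mul
      ((tendsto_inv_atTop_nhds_zero_nat (𝕜 := ℝ)).pow (d+1))).const_mul (r.coeff i)
    rw [zero_pow (by omega), mul_zero, mul_zero] at h2
    refine h2.congr ?_
    intro n
    rw [pow_add (n:ℝ) i (d+1), div_eq_mul_inv, div_eq_mul_inv, inv_pow]
    simp only [mul_inv]
    ring

theorem desc_tendsto (j : ℕ) : Filter.Tendsto (fun n : ℕ => (n.descFactorial j : ℝ) / (n:ℝ)^j)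
    Filter.atTop (nhds 1) := by
  have := isEquivalent_descFactorial j
  rw [Asymptotics.isEquivalent_iff_tendsto_one] at this
  · exact this
  · filter_upwards [Filter.eventually_gt_atTop 0] with n hn
    have : (0:ℝ) < n := by exact_mod_cast hn
    positivity

theorem choose_tendsto (j : ℕ) : Filter.Tendsto (fun n : ℕ => (n.choose j : ℝ) / (n:ℝ)^j)
    Filter.atTop (nhds (1 / j.factorial)) := by
  have := (desc_tendsto j).div_const (j.factorial : ℝ)
  refine this.congr ?_
  intro n
  have hj : (j.factorial : ℝ) ≠ 0 := by positivity
  rw [Nat.descFactorial_eq_factorial_mul_choose]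
  push_cast
  field_simp

theorem SC_pow : SC (fun n => (1 + X)^n) (fun _ => 1) (fun j => 1 / j.factorial) := by
  intro j
  simpa [coeff_one_add_X_pow] using choose_tendsto j

theorem SC_opG : SC opG cc (fun j => rf j / (j.factorial : ℝ)^2) := by
  intro j
  have h := (desc_tendsto j).const_mul (rf j / (j.factorial : ℝ)^2)
  rw [mul_one] at h
  refine h.congr ?_
  intro n
  have := (cc_pos n).ne'
  rw [opG_coeff, gg]
  field_simp

theorem SC_opT (q r : Polynomial ℝ) (m : ℕ) (hq : q.natDegree ≤ m) (hr : r.natDegree ≤ m) :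
    SC (fun n => opT q r ((1 + X)^n)) (fun n => (n:ℝ)^m * cc n)
      (fun j => r.coeff m * (rf (j+m) / (j.factorial : ℝ)^2)) := by
  intro j
  have h1 := SC_aeval SC_opG r m hr j
  have h2 := (SC_aeval SC_pow q m hq j).mul cc_tendsto.inv_tendsto_atTop
  have h3 := h2.add h1
  rw [mul_zero, zero_add] at h3
  have e : r.coeff m * ((((j+m).factorial : ℝ) / j.factorial)^2 *
      (rf (j+m) / ((j+m).factorial : ℝ)^2)) = r.coeff m * (rf (j+m) / (j.factorial : ℝ)^2) := by
    have : (j.factorial : ℝ) ≠ 0 := by positivity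
    have : ((j+m).factorial : ℝ) ≠ 0 := by positivity
    field_simp
  beta_reduce at h3 ⊢
  rw [e] at h3
  refine h3.congr ?_
  intro n
  rw [opT, LinearMap.add_apply, LinearMap.comp_apply, opS_pow, coeff_add]
  simp only [div_eq_mul_inv, mul_inv, Pi.inv_apply]
  ring

/-! ### Part 5 : the limit coefficients -/

noncomputable def ff (m : ℕ) : ℕ → ℝ
  | 0 => 1
  | j+1 => ff m j * (m + 1/2 - j)

theorem ff_pos (m : ℕ) : ∀ j ≤ m + 1, 0 < ff m j := by
  intro j
  induction j with
  | zero => intro _; simp [ff]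
  | succ j ih =>
    intro hj
    rw [ff]
    have h1 : (j:ℝ) ≤ m := by exact_mod_cast (by omega : j ≤ m)
    exact mul_pos (ih (by omega)) (by linarith)

theorem diff_beta (m j : ℕ) : ∀ i : ℕ,
    (fwdDiff 1)^[j] (fun i : ℕ => rf (i+m) / (i.factorial : ℝ)) i
      = rf (i+m) * ff m j / ((i+j).factorial : ℝ) := by
  induction j with
  | zero => intro i; simp [ff]
  | succ j ih =>
    intro i
    rw [Function.iterate_succ_apply', fwdDiff, ih, ih, ff,
      show i + 1 + m = (i + m) + 1 by ring, rf, show i + 1 + j = (i + j) + 1 by ring,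
      show i + (j + 1) = (i + j) + 1 by ring, Nat.factorial_succ]
    have : ((i+j).factorial : ℝ) ≠ 0 := by positivity
    push_cast
    field_simp
    ring

theorem limit_coeff (m j : ℕ) (ρ : ℝ) :
    (j.factorial : ℝ) * ∑ x ∈ antidiagonal j,
      (ρ * (rf (x.1+m) / (x.1.factorial : ℝ)^2)) * ((-1)^x.2 * (1 / (x.2.factorial : ℝ)))
      = ρ * rf m * ff m j / (j.factorial : ℝ) := by
  have h := fwdDiff_iter_eq_sum_shift 1 (fun i : ℕ => rf (i+m) / (i.factorial : ℝ)) j 0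
  rw [diff_beta] at h
  simp only [zero_add] at h
  rw [mul_assoc ρ, mul_div_assoc ρ, h, Finset.Nat.sum_antidiagonal_eq_sum_range_succ_mk, Finset.mul_sum,
    Finset.mul_sum]
  refine Finset.sum_congr rfl ?_
  intro i hi
  have hij : i ≤ j := by simp at hi; omega
  have h1 : ((j.choose i : ℕ) : ℝ) = j.factorial / (i.factorial * (j-i).factorial) :=
    Nat.cast_choose ℝ hij
  have a1 : (i.factorial : ℝ) ≠ 0 := by positivity
  have a2 : ((j-i).factorial : ℝ) ≠ 0 := by positivity
  simp only [zsmul_eq_mul, smul_eq_mul, mul_one]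
  push_cast
  rw [h1]
  field_simp

theorem main_ineq (q r : Polynomial ℝ) (m : ℕ) (hq : q.natDegree ≤ m) (hr : r.natDegree ≤ m)
    (hs : ∀ n, (opT q r ((1 + X)^n)).Splits) (hρ : r.coeff m ≠ 0) : False := by
  set ρ := r.coeff m with hρd
  let A : ℕ → Polynomial ℝ := fun n =>
    (opT q r ((1 + X)^n)).comp (C ((n:ℝ)⁻¹) * X) * ((1 + X)^n : Polynomial ℝ).comp (C (-(n:ℝ)⁻¹) * X)
  have hdeg : ∀ a : ℝ, (C a * X : Polynomial ℝ).natDegree ≤ 1 := fun a => by compute_degree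
  have hA : ∀ n, (A n).Splits := by
    intro n
    refine ((hs n).comp_of_natDegree_le_one (hdeg _)).mul (Splits.comp_of_natDegree_le_one ?_ (hdeg _))
    refine Splits.pow (Splits.of_natDegree_le_one ?_) n
    compute_degree
  let κ : ℕ → ℝ := fun n => (n:ℝ)^m * cc n
  have hlim : ∀ j, Filter.Tendsto (fun n => (j.factorial : ℝ) * (A n).coeff j / κ n) Filter.atTop
      (nhds (ρ * rf m * ff m j / (j.factorial : ℝ))) := by
    intro j
    rw [← limit_coeff]
    have h1 : Filter.Tendsto (fun n : ℕ => (j.factorial : ℝ) * ∑ x ∈ antidiagonal j,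
        ((opT q r ((1 + X)^n)).coeff x.1 / ((n:ℝ)^x.1 * κ n)) *
          ((-1)^x.2 * ((n.choose x.2 : ℝ) / (n:ℝ)^x.2))) Filter.atTop
        (nhds ((j.factorial : ℝ) * ∑ x ∈ antidiagonal j,
      (ρ * (rf (x.1+m) / (x.1.factorial : ℝ)^2)) * ((-1)^x.2 * (1 / (x.2.factorial : ℝ))))) := by
      refine Filter.Tendsto.const_mul _ (tendsto_finsetSum _ ?_)
      intro x _
      exact (SC_opT q r m hq hr x.1).mul ((choose_tendsto x.2).const_mul _)
    refine h1.congr ?_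
    intro n
    rw [mul_div_assoc, coeff_mul, Finset.sum_div]
    congr 1
    refine Finset.sum_congr rfl ?_
    intro x _
    rw [comp_C_mul_X_coeff, comp_C_mul_X_coeff, coeff_one_add_X_pow, neg_pow (n:ℝ)⁻¹, inv_pow, inv_pow]
    simp only [div_eq_mul_inv, mul_inv]
    ring
  have hN : ρ * rf m * ff m (m+1) / ((m+1).factorial : ℝ) *
      (ρ * rf m * ff m (m+1+2) / ((m+1+2).factorial : ℝ))
      ≤ (ρ * rf m * ff m (m+1+1) / ((m+1+1).factorial : ℝ))^2 := by
    refine le_of_tendsto_of_tendsto' ((hlim (m+1)).mul (hlim (m+1+2))) ((hlim (m+1+1)).pow 2) ?_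
    intro n
    rw [div_pow, div_mul_div_comm, ← pow_two]
    exact div_le_div_of_nonneg_right (splits_newton (hA n) (m+1)) (sq_nonneg _)
  have hf := ff_pos m (m+1) le_rfl
  rw [show ff m (m+1+2) = ff m (m+1+1) * (m + 1/2 - ((m+1+1 : ℕ):ℝ)) from rfl,
    show ff m (m+1+1) = ff m (m+1) * (m + 1/2 - ((m+1 : ℕ):ℝ)) from rfl,
    show (m+1+2).factorial = (m+1+1+1) * ((m+1+1) * (m+1).factorial) from rfl,
    show (m+1+1).factorial = (m+1+1) * (m+1).factorial from rfl] at hN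
  push_cast at hN
  set F : ℝ := ρ * rf m * ff m (m+1) / ((m+1).factorial : ℝ) with hF
  have hF0 : F ≠ 0 := by
    have := (rf_pos m).ne'
    have := hf.ne'
    have : ((m+1).factorial : ℝ) ≠ 0 := by positivity
    rw [hF]; positivity
  have hm0 : (0:ℝ) ≤ m := Nat.cast_nonneg m
  have e1 : ρ * rf m * (ff m (m+1) * (m + 1/2 - ((m:ℝ)+1)) * (m + 1/2 - ((m:ℝ)+1+1))) /
      (((m:ℝ)+1+1+1) * (((m:ℝ)+1+1) * ((m+1).factorial : ℝ))) = F * (3/4) / ((m+3)*(m+2)) := by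
    rw [hF]
    have : ((m+1).factorial : ℝ) ≠ 0 := by positivity
    field_simp
    ring
  have e2 : ρ * rf m * (ff m (m+1) * (m + 1/2 - ((m:ℝ)+1))) /
      (((m:ℝ)+1+1) * ((m+1).factorial : ℝ)) = F * (-1/2) / (m+2) := by
    rw [hF]
    have : ((m+1).factorial : ℝ) ≠ 0 := by positivity
    field_simp
    ring
  rw [e1, e2] at hN
  have hF2 : 0 < F^2 := by positivity
  have e3 : (F * (-1/2) / (m+2))^2 - F * (F * (3/4) / ((m+3)*(m+2)))
      = F^2 * (-(2*m+3)) / (4 * (m+2)^2 * (m+3)) := by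
    field_simp
    ring
  have : F^2 * (-(2*m+3)) / (4 * (m+2)^2 * (m+3)) < 0 := by
    apply div_neg_of_neg_of_pos
    · nlinarith
    · positivity
  linarith

theorem stmt8 (p : Polynomial ℝ) (hp : Odd p.natDegree) :
    ¬ IsLegendreMS (fun k : ℕ => p.eval (k : ℝ)) := by
  intro h
  obtain ⟨m, hm⟩ := hp
  obtain ⟨q, r, hq, hr, hc, hx⟩ := decomp m p hm.le
  have hT := h (opTx q r) (by
    intro k
    beta_reduce
    rw [opTx_legendre, hx])
  refine main_ineq q r m hq hr ?_ ?_
  · intro n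
    have hchB : (C (1/2) * (X - 1) : Polynomial ℝ).natDegree ≤ 1 := by compute_degree
    have hdA : (C 2 * X + 1 : Polynomial ℝ).natDegree ≤ 1 := by compute_degree
    have hAB : ∀ f, chA (chB f) = f := by
      intro f
      have : chA.comp chB = AlgHom.id ℝ _ := by
        ext1
        simp only [chA, chB, AlgHom.comp_apply, aeval_X, map_sub, map_mul, map_one, AlgHom.id_apply]
        rw [← algebraMap_eq, AlgHom.commutes, algebraMap_eq, add_sub_cancel_right, ← mul_assoc,
          ← C_mul]
        norm_num
      exact congrArg (fun φ => φ f) this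
    have h1 : (chB ((1 + X)^n)).Splits := by
      rw [chB, ← comp_eq_aeval]
      refine Splits.comp_of_natDegree_le_one (Splits.pow (Splits.of_natDegree_le_one ?_) n) hchB
      compute_degree
    have h2 := hyp_splits (hT _ (splits_hyp h1))
    have h3 : chA (opTx q r (chB ((1 + X)^n))) = opT q r ((1 + X)^n) := by
      simp only [opTx, LinearMap.comp_apply, AlgHom.toLinearMap_apply]
      rw [hAB, hAB]
    rw [← h3, chA, ← comp_eq_aeval]
    exact h2.comp_of_natDegree_le_one hdA
  · rw [hc, ← hm]
    have : p ≠ 0 := by rintro rfl; simp at hm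
    have h0 : p.coeff p.natDegree ≠ 0 := by
      rw [coeff_natDegree]; exact leadingCoeff_ne_zero.2 this
    exact div_ne_zero h0 two_ne_zero
end

section
/- Suppose (γ_k)_{k≥0} is a multiplier sequence for the Legendre basis and there exists a polynomial p ∈ ℝ[x] with γ_k = p(k) for all natural numbers k. Then there exists a polynomial h ∈ ℝ[x] such that p(x) = h(x²+x); in particular, γ_k = h(k²+k) for all k. -/
open Polynomial Finset

open Filter Topology

lemma laguerre_prod (m : Multiset ℝ) (x : ℝ) :
    ((m.map (X - C ·)).prod).eval x * (derivative (derivative (m.map (X - C ·)).prod)).eval x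
      ≤ ((derivative (m.map (X - C ·)).prod).eval x) ^ 2 := by
  induction m using Multiset.induction with
  | empty => simp
  | cons c m ih =>
    simp only [Multiset.map_cons, Multiset.prod_cons]
    set g := (m.map (X - C ·)).prod with hg
    simp only [derivative_mul, derivative_add, derivative_sub, derivative_X, derivative_C,
      eval_add, eval_mul, eval_sub, eval_X, eval_C, sub_zero, one_mul]
    nlinarith [sq_nonneg (g.eval x), mul_nonneg (sq_nonneg (x - c)) (sub_nonneg.2 ih)]

lemma laguerre_splits {f : ℝ[X]} (hf : f.Splits) (x : ℝ) :
    f.eval x * (derivative (derivative f)).eval x ≤ ((derivative f).eval x) ^ 2 := by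
  obtain ⟨m, hm⟩ := splits_iff_exists_multiset.1 hf
  have h := laguerre_prod m x
  set g := (m.map (X - C ·)).prod with hg
  rw [hm]
  simp only [derivative_C_mul, eval_mul, eval_C]
  nlinarith [mul_nonneg (sq_nonneg f.leadingCoeff) (sub_nonneg.2 h)]

lemma splits_derivative_real {f : ℝ[X]} (hf : f.Splits) : (derivative f).Splits := by
  rw [splits_iff_card_roots] at hf ⊢
  have h1 := card_roots_le_derivative f
  have h2 := card_roots' (derivative f)
  have h3 := natDegree_derivative_le f
  omega

lemma splits_iterate_derivative_real {f : ℝ[X]} (hf : f.Splits) (j : ℕ) :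
    (derivative^[j] f).Splits := by
  induction j with
  | zero => simpa
  | succ j ih => rw [Function.iterate_succ_apply']; exact splits_derivative_real ih

lemma newton_coeff {f : ℝ[X]} (hf : f.Splits) (j : ℕ) :
    ((j.factorial : ℝ) * f.coeff j) * (((j + 2).factorial : ℝ) * f.coeff (j + 2)) ≤
      (((j + 1).factorial : ℝ) * f.coeff (j + 1)) ^ 2 := by
  have h := laguerre_splits (splits_iterate_derivative_real hf j) 0
  rw [← Function.iterate_succ_apply' derivative, ← Function.iterate_succ_apply' derivative] at h
  simp only [← coeff_zero_eq_eval_zero, coeff_iterate_derivative, zero_add, nsmul_eq_mul,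
    Nat.descFactorial_self, Nat.succ_eq_add_one] at h
  exact h

lemma Hyperbolic.splits {f : ℝ[X]} (hf : Hyperbolic f) : f.Splits := by
  rcases hf with rfl | hf
  · exact Splits.zero
  · apply Splits.of_splits_map_of_injective (i := algebraMap ℝ ℂ) (RingHom.injective _)
      (IsAlgClosed.splits _)
    intro z hz
    have hz' := (mem_roots'.1 hz).2
    have h0 : aeval z f = 0 := by
      rw [IsRoot.def, eval_map_algebraMap] at hz'
      exact hz'
    exact ⟨z.re, by apply Complex.ext <;> simp [hf z h0]⟩

lemma hyperbolic_pow (c : ℝ) (N : ℕ) : Hyperbolic (C c * (X - C 1) ^ N) := by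
  by_cases hc : c = 0
  · left; simp [hc]
  · right
    intro z hz
    simp only [map_mul, aeval_C, map_pow, map_sub, aeval_X, mul_eq_zero] at hz
    rcases hz with h | h
    · simp [hc] at h
    · have h2 : z - 1 = 0 := eq_zero_of_pow_eq_zero (n := N) (by simpa using h)
      have : z = 1 := by linear_combination h2
      simp [this]

/-- The factors `∏_{i<j} (y - i(i+1))`. -/
noncomputable def ePr (j : ℕ) (y : ℝ) : ℝ := ∏ i ∈ range j, (y - i * (i + 1))

lemma ePr_succ (j : ℕ) (y : ℝ) : ePr (j + 1) y = ePr j y * (y - j * (j + 1)) := by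
  simp [ePr, prod_range_succ]

lemma ePr_zero (y : ℝ) : ePr 0 y = 1 := by simp [ePr]

lemma ePr_eq (k j : ℕ) :
    ((j + k).factorial : ℝ) * (k.choose j : ℝ) * j.factorial =
      k.factorial * ePr j ((k : ℝ) ^ 2 + k) := by
  induction j with
  | zero => simp [ePr_zero]
  | succ j ih =>
    have h1 : (k.choose (j + 1) : ℝ) * (j + 1) = k.choose j * (k - j) := by
      rcases le_or_gt j k with h | h
      · have := Nat.choose_succ_right_eq k j
        rw [← Nat.cast_sub h]
        exact_mod_cast this
      · rw [Nat.choose_eq_zero_of_lt h, Nat.choose_eq_zero_of_lt (by omega)]; simp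
    rw [ePr_succ, ← mul_assoc, ← ih, show j + 1 + k = (j + k) + 1 by ring, Nat.factorial_succ,
      Nat.factorial_succ]
    push_cast
    linear_combination ((j + k + 1 : ℝ) * (j + k).factorial * j.factorial) * h1

lemma taylor_legendreP_coeff (k j : ℕ) :
    (taylor 1 (legendreP k)).coeff j = ePr j ((k : ℝ) ^ 2 + k) / (2 ^ j * (j.factorial : ℝ) ^ 2) := by
  have hcomm : ∀ (n : ℕ) (f : ℝ[X]), taylor 1 (derivative^[n] f) = derivative^[n] (taylor 1 f) := by
    intro n
    induction n with
    | zero => intro f; rfl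
    | succ n ih =>
      intro f
      rw [Function.iterate_succ_apply, Function.iterate_succ_apply, ih]
      congr 1
      simp [taylor_apply, derivative_comp]
  have hpoly : taylor (1 : ℝ) ((X ^ 2 - 1) ^ k) = (X + C 2) ^ k * X ^ k := by
    rw [taylor_pow, ← mul_pow]
    congr 1
    simp only [map_sub, taylor_X_pow, taylor_one]
    rw [show (C 2 : ℝ[X]) = C 1 + C 1 by rw [← C_add]; norm_num]
    simp only [C_1]; ring
  rw [legendreP, map_smul, hcomm, hpoly, coeff_smul, coeff_iterate_derivative, coeff_mul_X_pow,
    coeff_X_add_C_pow, smul_eq_mul, nsmul_eq_mul]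
  have h1 := ePr_eq k j
  have h2 : ((j + k).descFactorial k : ℝ) * j.factorial = (j + k).factorial := by
    have := Nat.factorial_mul_descFactorial (show k ≤ j + k by omega)
    rw [Nat.add_sub_cancel] at this
    rw [← this]; push_cast; ring
  have hj : (j.factorial : ℝ) ≠ 0 := by positivity
  have hk : (k.factorial : ℝ) ≠ 0 := by positivity
  rcases le_or_gt j k with h | h
  · have h3 : (2 : ℝ) ^ (k - j) * 2 ^ j = 2 ^ k := by rw [← pow_add]; congr 1; omega
    rw [← h2] at h1
    rw [← h3]
    have : (2 : ℝ) ^ (k - j) ≠ 0 := by positivity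
    generalize ePr j ((k : ℝ) ^ 2 + k) = e at *
    field_simp
    linear_combination h1
  · rw [Nat.choose_eq_zero_of_lt h] at h1 ⊢
    have : ePr j ((k : ℝ) ^ 2 + k) = 0 := by
      simpa [hk] using h1.symm
    simp [this]

lemma ePr_eq_zero {k j : ℕ} (h : k < j) : ePr j ((k : ℝ) ^ 2 + k) = 0 := by
  have h1 := ePr_eq k j
  rw [Nat.choose_eq_zero_of_lt h] at h1
  have hk : (k.factorial : ℝ) ≠ 0 := by positivity
  simpa [hk] using h1.symm

lemma degree_legendreP (k : ℕ) : (legendreP k).degree = k := by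
  rw [← degree_taylor _ 1]
  apply degree_eq_of_le_of_coeff_ne_zero
  · rw [degree_le_iff_coeff_zero]
    intro m hm
    rw [taylor_legendreP_coeff, ePr_eq_zero (by exact_mod_cast hm), zero_div]
  · rw [taylor_legendreP_coeff]
    have h1 := ePr_eq k k
    have : ePr k ((k : ℝ) ^ 2 + k) ≠ 0 := by
      intro h
      rw [h, Nat.choose_self] at h1
      have : ((k + k).factorial : ℝ) * ((1 : ℕ) : ℝ) * k.factorial ≠ 0 := by positivity
      simp_all
    positivity

lemma exists_legendre_op (γ : ℕ → ℝ) : ∃ T : ℝ[X] →ₗ[ℝ] ℝ[X],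
    ∀ k, T (legendreP k) = γ k • legendreP k := by
  let S : Polynomial.Sequence ℝ := ⟨legendreP, degree_legendreP⟩
  have hS : ∀ i, IsUnit (S i).leadingCoeff := fun i => by
    simp
  refine ⟨(S.basis hS).constr ℝ (fun k => γ k • legendreP k), fun k => ?_⟩
  have := (S.basis hS).constr_basis ℝ (fun k => γ k • legendreP k) k
  rwa [S.basis_eq_self hS] at this

/-- weights -/
noncomputable def wgt (N : ℕ) : ℕ → ℝ
  | 0 => 1
  | k + 1 => wgt N k * ((N : ℝ) - k) / ((N : ℝ) + k + 2)

lemma wgt_succ (N k : ℕ) : wgt N (k + 1) * ((N : ℝ) + k + 2) = wgt N k * ((N : ℝ) - k) := by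
  have : (N : ℝ) + k + 2 ≠ 0 := by positivity
  rw [wgt]; field_simp

/-- weighted alternating sum -/
noncomputable def wsum (N : ℕ) (q : ℝ → ℝ) : ℝ :=
  ∑ k ∈ range (N + 1), (-1) ^ k * wgt N k * q k

lemma wsum_add (N : ℕ) (q r : ℝ → ℝ) : wsum N (fun k => q k + r k) = wsum N q + wsum N r := by
  simp [wsum, mul_add, sum_add_distrib]

lemma wsum_mul (N : ℕ) (c : ℝ) (q : ℝ → ℝ) : wsum N (fun k => c * q k) = c * wsum N q := by
  simp only [wsum, mul_sum]
  exact sum_congr rfl fun k _ => by ring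

lemma wsum_tele (N : ℕ) (s : ℝ → ℝ) :
    wsum N (fun k => (N + k + 1) * s k + (N - k) * s (k + 1)) = (N + 1) * s 0 := by
  have key : ∀ M : ℕ, ∑ k ∈ range M, (-1) ^ k * wgt N k *
      (((N : ℝ) + k + 1) * s k + (N - k) * s (k + 1)) =
      (N + 1) * s 0 - (-1) ^ M * (N + M + 1) * wgt N M * s M := by
    intro M
    induction M with
    | zero => simp [wgt]
    | succ M ih =>
      rw [sum_range_succ, ih]
      have := wgt_succ N M
      push_cast
      linear_combination ((-1) ^ (M + 1) * s (M + 1)) * this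
  have h0 : wgt N (N + 1) = 0 := by simp [wgt]
  have := key (N + 1)
  rw [h0] at this
  rw [wsum, this]; ring

/-- odd products -/
noncomputable def tPr (j : ℕ) (k : ℝ) : ℝ := ePr j (k ^ 2 + k) * (k - j)

lemma tPr_shift (j : ℕ) (k : ℝ) : tPr j (k + 1) = ePr j (k ^ 2 + k) * (k + j + 1) := by
  have key : ∀ j : ℕ, ePr j ((k + 1) ^ 2 + (k + 1)) * (k + 1 - j) =
      ePr j (k ^ 2 + k) * (k + j + 1) := by
    intro j
    induction j with
    | zero => simp [ePr_zero]
    | succ j ih =>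
      rw [ePr_succ, ePr_succ]
      push_cast
      linear_combination ((k - j) * (k + j + 2)) * ih
  exact key j

lemma tPr_zero (j : ℕ) : tPr j 0 = 0 := by
  cases j with
  | zero => simp [tPr]
  | succ j =>
    have : ePr (j + 1) 0 = 0 := by
      rw [ePr]; exact prod_eq_zero (i := 0) (by simp) (by simp)
    simp [tPr, this]

lemma wsum_odd (N j : ℕ) :
    ((N : ℝ) - j) * wsum N (fun k => (2 * k + 1) * ePr j (k ^ 2 + k)) = 0 := by
  have h := wsum_tele N (tPr j)
  rw [tPr_zero, mul_zero] at h
  rw [← wsum_mul, ← h]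
  congr 1
  funext k
  rw [tPr_shift, tPr]
  ring

lemma wsum_even_zero (N : ℕ) : (2 * (N : ℝ) + 1) * wsum N (fun k => ePr 0 (k ^ 2 + k)) = N + 1 := by
  have h := wsum_tele N (fun _ => 1)
  rw [mul_one] at h
  rw [← wsum_mul, ← h]
  congr 1
  funext k
  rw [ePr_zero]
  ring

lemma wsum_even (N j : ℕ) :
    (2 * (N : ℝ) - 2 * j - 1) * wsum N (fun k => ePr (j + 1) (k ^ 2 + k)) =
     - ((j + 1) * (2 * j + 1) * (N - j)) * wsum N (fun k => ePr j (k ^ 2 + k)) := by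
  have h := wsum_tele N (fun k => k * tPr j k)
  rw [zero_mul, mul_zero] at h
  rw [← sub_eq_zero, sub_eq_add_neg, ← neg_mul, ← wsum_mul, ← wsum_mul, ← wsum_add, ← h]
  congr 1
  funext k
  rw [tPr_shift, tPr, ePr_succ]
  ring

/-- limits -/
noncomputable def eLim : ℕ → ℝ
  | 0 => 1 / 2
  | j + 1 => -((j + 1) * (2 * j + 1) / 2) * eLim j

lemma eLim_ne_zero (j : ℕ) : eLim j ≠ 0 := by
  induction j with
  | zero => simp [eLim]
  | succ j ih =>
    rw [eLim]
    exact mul_ne_zero (neg_ne_zero.2 (by positivity)) ih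

lemma tendsto_ratio (a b c d : ℝ) (hc : c ≠ 0) :
    Tendsto (fun N : ℕ => (a * (N : ℝ) + b) / (c * (N : ℝ) + d)) atTop (𝓝 (a / c)) := by
  have h1 : Tendsto (fun N : ℕ => (a + b / (N : ℝ)) / (c + d / (N : ℝ))) atTop
      (𝓝 ((a + 0) / (c + 0))) :=
    (tendsto_const_nhds.add (tendsto_const_div_atTop_nhds_zero_nat b)).div
      (tendsto_const_nhds.add (tendsto_const_div_atTop_nhds_zero_nat d)) (by simpa)
  simp only [add_zero] at h1
  refine h1.congr' ?_
  filter_upwards [eventually_gt_atTop 0] with N hN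
  have : (N : ℝ) ≠ 0 := by positivity
  rw [← mul_div_mul_left _ _ this]
  congr 1 <;> field_simp

lemma tendsto_wsum_even (j : ℕ) :
    Tendsto (fun N => wsum N (fun k => ePr j (k ^ 2 + k))) atTop (𝓝 (eLim j)) := by
  induction j with
  | zero =>
    have := tendsto_ratio 1 1 2 1 (by norm_num)
    rw [eLim]
    refine this.congr fun N => ?_
    have h := wsum_even_zero N
    have : (2 * (N : ℝ) + 1) ≠ 0 := by positivity
    rw [div_eq_iff this]
    linarith
  | succ j ih =>
    have := (tendsto_ratio (-((j + 1) * (2 * j + 1))) ((j + 1) * (2 * j + 1) * j) 2 (-(2 * j + 1))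
      (by norm_num)).mul ih
    rw [eLim]
    rw [show -((j + 1) * (2 * j + 1) / 2) * eLim j = -((j + 1) * (2 * j + 1)) / 2 * eLim j by ring]
    refine this.congr' ?_
    filter_upwards [eventually_gt_atTop j] with N hN
    have h := wsum_even N j
    have : (j : ℝ) + 1 ≤ N := by exact_mod_cast hN
    have : (2 * (N : ℝ) + -(2 * j + 1)) ≠ 0 := by intro h; linarith
    rw [div_mul_eq_mul_div, div_eq_iff this]
    linear_combination -h

lemma tendsto_wsum_odd (g : ℝ[X]) : ∀ j : ℕ,
    Tendsto (fun N => wsum N (fun k => (2 * k + 1) * (g.eval (k ^ 2 + k) * ePr j (k ^ 2 + k))))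
      atTop (𝓝 0) := by
  induction g using Polynomial.recOnHorner with
  | M0 => intro j; simp [wsum]
  | MC g a _ _ ih =>
    intro j
    have h0 : Tendsto (fun N => wsum N (fun k => (2 * k + 1) * ePr j (k ^ 2 + k)))
      atTop (𝓝 0) := by
      refine tendsto_const_nhds.congr' ?_
      filter_upwards [eventually_gt_atTop j] with N hN
      have h := wsum_odd N j
      have : (j : ℝ) < N := by exact_mod_cast hN
      rcases mul_eq_zero.1 h with h | h
      · linarith
      · exact h.symm
    have := (ih j).add (h0.const_mul a)
    simp only [mul_zero, add_zero] at this
    refine this.congr fun N => ?_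
    rw [← wsum_mul, ← wsum_add]
    congr 1; funext k
    simp; ring
  | MX g _ ih =>
    intro j
    have := (ih (j + 1)).add ((ih j).const_mul ((j : ℝ) * (j + 1)))
    simp only [mul_zero, add_zero] at this
    refine this.congr fun N => ?_
    rw [← wsum_mul, ← wsum_add]
    congr 1; funext k
    simp [ePr_succ]; ring

/-- multiplication by `y` on the polynomial side -/
noncomputable def yOp (R : ℝ[X]) : ℝ[X] :=
  (X + C 1) * (X * R - (X + C (1 / 2)) * taylor 1 R)

lemma degree_yOp {R : ℝ[X]} (hR : R ≠ 0) : (yOp R).degree = R.degree + 1 := by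
  rw [yOp, degree_mul, degree_X_add_C, add_comm]
  congr 1
  have hlin : X * R - (X + C (1 / 2)) * taylor 1 R =
      X * (R - taylor 1 R) - C (1 / 2) * taylor 1 R := by ring
  rw [hlin, degree_eq_natDegree hR]
  have hdeg : (taylor 1 R).natDegree = R.natDegree := natDegree_taylor R 1
  have hlc : (taylor 1 R).coeff R.natDegree = R.leadingCoeff := coeff_taylor_natDegree ..
  have hlt : (R - taylor 1 R).degree < R.natDegree := by
    rw [← degree_eq_natDegree hR]
    apply degree_sub_lt_left (degree_taylor R 1).symm hR (by rw [leadingCoeff_taylor])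
  have hlc0 : R.leadingCoeff ≠ 0 := leadingCoeff_ne_zero.2 hR
  apply degree_eq_of_le_of_coeff_ne_zero
  · rw [degree_le_iff_coeff_zero]
    intro m hm
    have hm' : R.natDegree < m := by exact_mod_cast hm
    obtain ⟨m, rfl⟩ : ∃ n, m = n + 1 := ⟨m - 1, by omega⟩
    have z1 : (taylor 1 R).coeff (m + 1) = 0 :=
      coeff_eq_zero_of_natDegree_lt (by rw [hdeg]; exact hm')
    have z2 : (R - taylor 1 R).coeff m = 0 :=
      coeff_eq_zero_of_degree_lt (hlt.trans_le (by exact_mod_cast Nat.lt_succ_iff.1 hm'))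
    rw [coeff_sub, coeff_X_mul, coeff_C_mul, z1, z2]
    simp
  · rw [coeff_sub, coeff_C_mul, hlc]
    rcases Nat.eq_zero_or_pos R.natDegree with h | h
    · rw [h]; simp [hlc0]
    · obtain ⟨r, hr⟩ : ∃ n, R.natDegree = n + 1 := ⟨R.natDegree - 1, by omega⟩
      have hc : (R - taylor 1 R).coeff r = -((r + 1) * R.leadingCoeff) := by
        have : (hasseDeriv r R) = C (R.coeff r) + C ((r + 1) * R.leadingCoeff) * X := by
          ext m
          rw [hasseDeriv_coeff]
          rcases m with _ | _ | m
          · simp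
          · have : R.coeff (0 + 1 + r) = R.leadingCoeff := by
              rw [leadingCoeff, hr]; congr 1; ring
            rw [this]
            have h1 : (0 + 1 + r).choose r = r + 1 := by
              rw [show 0 + 1 + r = r + 1 by ring, Nat.choose_succ_self_right]
            rw [h1]
            simp [coeff_C]
          · rw [coeff_eq_zero_of_natDegree_lt (by omega)]
            rw [coeff_add, coeff_C_mul, coeff_X, coeff_C]
            simp
        rw [coeff_sub, taylor_coeff, this]
        simp
      rw [hr, coeff_X_mul, hc]
      have : -((r + 1) * R.leadingCoeff) - 1 / 2 * R.leadingCoeff =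
        -((r + 1 + 1 / 2) * R.leadingCoeff) := by ring
      rw [this]
      exact neg_ne_zero.2 (mul_ne_zero (by positivity) hlc0)

lemma exists_R (g : ℝ[X]) : ∃ R : ℝ[X], R.degree = g.degree ∧ ∀ j : ℕ,
    Tendsto (fun N => wsum N (fun k => (g.eval (k ^ 2 + k) * ePr j (k ^ 2 + k))))
      atTop (𝓝 (eLim j * R.eval (j : ℝ))) := by
  induction g using Polynomial.recOnHorner with
  | M0 => exact ⟨0, rfl, fun j => by simp [wsum]⟩
  | MC g a hg0 ha ih =>
    obtain ⟨R, hR, h⟩ := ih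
    refine ⟨R + C a, ?_, fun j => ?_⟩
    · by_cases hg : g = 0
      · have : R = 0 := by rw [← degree_eq_bot, hR, hg, degree_zero]
        rw [this, hg]
      · have hpos : 0 < g.degree := by
          by_contra hcon
          have := eq_C_of_degree_le_zero (not_lt.1 hcon)
          rw [hg0, C_0] at this
          exact hg this
        rw [degree_add_C hpos, degree_add_C (hR ▸ hpos), hR]
    · have := (h j).add ((tendsto_wsum_even j).const_mul a)
      rw [eval_add, eval_C, mul_add, mul_comm (eLim j) a]
      refine this.congr fun N => ?_
      rw [← wsum_mul, ← wsum_add]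
      congr 1; funext k
      simp; ring
  | MX g hg ih =>
    obtain ⟨R, hR, h⟩ := ih
    have hR0 : R ≠ 0 := by
      intro h0
      rw [h0, degree_zero] at hR
      exact hg (degree_eq_bot.1 hR.symm)
    refine ⟨yOp R, ?_, fun j => ?_⟩
    · rw [degree_yOp hR0, degree_mul, degree_X, hR]
    · have := (h (j + 1)).add ((h j).const_mul ((j : ℝ) * (j + 1)))
      have he : eLim j * (yOp R).eval (j : ℝ) = eLim (j + 1) * R.eval ((j + 1 : ℕ) : ℝ) +
          (j : ℝ) * (j + 1) * (eLim j * R.eval (j : ℝ)) := by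
        rw [eLim, yOp]
        simp only [eval_mul, eval_add, eval_sub, eval_X, eval_C, taylor_eval]
        push_cast; ring
      rw [he]
      refine this.congr fun N => ?_
      rw [← wsum_mul, ← wsum_add]
      congr 1; funext k
      simp [ePr_succ]; ring

lemma no_R {R : ℝ[X]} (hR : R ≠ 0)
    (h : ∀ j : ℕ, (2 * (j : ℝ) + 3) * (R.eval (j : ℝ) * R.eval ((j : ℝ) + 2)) ≤
      (2 * j + 1) * R.eval ((j : ℝ) + 1) ^ 2) : False := by
  have hlim : Tendsto (fun x : ℝ => R.eval (x + 1) / R.eval x) atTop (𝓝 1) := by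
    have := div_tendsto_atTop_leadingCoeff_div_of_degree_eq (taylor 1 R) R (degree_taylor R 1)
    rw [leadingCoeff_taylor, div_self (leadingCoeff_ne_zero.2 hR)] at this
    simpa only [taylor_eval] using this
  have hlimN : Tendsto (fun j : ℕ => R.eval ((j : ℝ) + 1) / R.eval (j : ℝ)) atTop (𝓝 1) :=
    hlim.comp tendsto_natCast_atTop_atTop
  have hev := hlimN.eventually (lt_mem_nhds (show (1 / 2 : ℝ) < 1 by norm_num))
  obtain ⟨M, hM⟩ := eventually_atTop.1 hev
  set ρ : ℕ → ℝ := fun j => R.eval ((j : ℝ) + 1) / R.eval (j : ℝ) with hρ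
  have hne : ∀ j ≥ M, R.eval (j : ℝ) ≠ 0 := by
    intro j hj h0
    have := hM j hj
    rw [h0, div_zero] at this
    linarith
  have hmono : ∀ j ≥ M, (2 * (j : ℝ) + 3) * ρ (j + 1) ≤ (2 * j + 1) * ρ j := by
    intro j hj
    have h0 := hne j hj
    have h1 : R.eval ((j : ℝ) + 1) ≠ 0 := by exact_mod_cast hne (j + 1) (by omega)
    have hp : 0 < R.eval ((j : ℝ) + 1) / R.eval (j : ℝ) := by linarith [hM j hj]
    have hpos : 0 < R.eval (j : ℝ) * R.eval ((j : ℝ) + 1) := by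
      have : R.eval (j : ℝ) * R.eval ((j : ℝ) + 1) =
        R.eval ((j : ℝ) + 1) / R.eval (j : ℝ) * R.eval (j : ℝ) ^ 2 := by field_simp
      rw [this]; positivity
    have hh := h j
    have e1 : ρ (j + 1) = (R.eval (j : ℝ) * R.eval ((j : ℝ) + 2)) /
        (R.eval (j : ℝ) * R.eval ((j : ℝ) + 1)) := by
      simp only [hρ]; push_cast
      rw [show (j : ℝ) + 1 + 1 = j + 2 by ring]
      field_simp
    have e2 : ρ j = R.eval ((j : ℝ) + 1) ^ 2 / (R.eval (j : ℝ) * R.eval ((j : ℝ) + 1)) := by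
      simp only [hρ]; field_simp
    rw [e1, e2, ← mul_div_assoc, ← mul_div_assoc]
    exact div_le_div_of_nonneg_right hh hpos.le
  have hbd : ∀ n : ℕ, (2 * ((M + n : ℕ) : ℝ) + 1) * ρ (M + n) ≤ (2 * M + 1) * ρ M := by
    intro n
    induction n with
    | zero => simp
    | succ n ih =>
      have := hmono (M + n) (by omega)
      refine le_trans ?_ ih
      refine le_trans (le_of_eq ?_) this
      rw [← add_assoc]
      push_cast; ring
  obtain ⟨n, hn⟩ := exists_nat_gt ((2 * M + 1) * ρ M)
  have h1 := hbd n
  have h2 := hM (M + n) (by omega)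
  have h2' : 1 / 2 < ρ (M + n) := h2
  push_cast at h1
  have : (0 : ℝ) ≤ M := by positivity
  have : (0 : ℝ) ≤ n := by positivity
  nlinarith

lemma decomp_s9 (n : ℕ) : ∀ p : ℝ[X], p.natDegree < n → ∃ a b : ℝ[X],
    p = a.comp (X ^ 2 + X) + (C 2 * X + C 1) * b.comp (X ^ 2 + X) := by
  induction n with
  | zero => intro p hp; omega
  | succ n ih =>
    intro p hp
    have hmon : (X ^ 2 + X : ℝ[X]).Monic := by monicity!
    have hdeg : (X ^ 2 + X : ℝ[X]).natDegree = 2 := by compute_degree!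
    have hmod := modByMonic_add_div p (X ^ 2 + X : ℝ[X])
    have hr : (p %ₘ (X ^ 2 + X)).natDegree < 2 := by
      refine lt_of_lt_of_eq ?_ hdeg
      exact natDegree_modByMonic_lt _ hmon (by intro h; rw [h] at hdeg; simp at hdeg)
    obtain ⟨c, d, hcd⟩ := exists_eq_X_add_C_of_natDegree_le_one (Nat.lt_succ_iff.1 hr)
    have hq : (p /ₘ (X ^ 2 + X)).natDegree < n ∨ p.natDegree < 2 := by
      rw [natDegree_divByMonic _ hmon, hdeg]; omega
    have lin : C c * X + C d = C (d - c / 2) + (C 2 * X + C 1) * C (c / 2) := by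
      have : (C c : ℝ[X]) = C 2 * C (c / 2) := by rw [← C_mul]; congr 1; ring
      rw [C_sub, this, C_1]; ring
    rcases hq with hq | hq
    · obtain ⟨a, b, hab⟩ := ih _ hq
      refine ⟨X * a + C (d - c / 2), X * b + C (c / 2), ?_⟩
      rw [← hmod, hcd, lin, hab]
      simp only [add_comp, mul_comp, X_comp, C_comp]
      ring
    · obtain ⟨c, d, hcd⟩ := exists_eq_X_add_C_of_natDegree_le_one (Nat.lt_succ_iff.1 hq)
      refine ⟨C (d - c / 2), C (c / 2), ?_⟩
      have lin : C c * X + C d = C (d - c / 2) + (C 2 * X + C 1) * C (c / 2) := by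
        have : (C c : ℝ[X]) = C 2 * C (c / 2) := by rw [← C_mul]; congr 1; ring
        rw [C_sub, this, C_1]; ring
      simp only [C_comp]
      rw [hcd, lin]

/-- test polynomial -/
noncomputable def testQ (N : ℕ) (γ : ℕ → ℝ) : ℝ[X] :=
  ∑ k ∈ range (N + 1), ((-1) ^ k * wgt N k * (2 * (k : ℝ) + 1) * γ k) • legendreP k

lemma taylor_testQ (N j : ℕ) (p : ℝ[X]) :
    (taylor 1 (testQ N (fun k => p.eval (k : ℝ)))).coeff j =
      wsum N (fun k => (2 * k + 1) * (p.eval k * ePr j (k ^ 2 + k))) /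
        (2 ^ j * (j.factorial : ℝ) ^ 2) := by
  rw [testQ, map_sum, finsetSum_coeff, wsum, sum_div]
  refine sum_congr rfl fun k _ => ?_
  rw [map_smul, coeff_smul, taylor_legendreP_coeff, smul_eq_mul]
  ring

lemma hyperbolic_testQ (N : ℕ) : Hyperbolic (testQ N (fun _ => 1)) := by
  have h : testQ N (fun _ => 1) =
      C ((taylor 1 (testQ N (fun _ => 1))).coeff N) * (X - C 1) ^ N := by
    apply taylor_injective (1 : ℝ)
    have e := fun j => taylor_testQ N j 1
    simp only [eval_one, one_mul] at e
    rw [taylor_mul, taylor_C, taylor_pow, map_sub, taylor_X, taylor_C, add_sub_cancel_right]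
    ext j
    rw [coeff_C_mul, coeff_X_pow]
    split_ifs with hj
    · rw [hj, mul_one]
    · rw [mul_zero, e]
      have h := wsum_odd N j
      rcases mul_eq_zero.1 h with h | h
      · exact absurd (by exact_mod_cast (sub_eq_zero.1 h).symm) hj
      · rw [h, zero_div]
  rw [h]
  exact hyperbolic_pow _ _

theorem stmt9 (γ : ℕ → ℝ) (hMS : IsLegendreMS γ) (p : Polynomial ℝ)
    (hp : ∀ k : ℕ, γ k = p.eval (k : ℝ)) :
    ∃ h : Polynomial ℝ, p = h.comp (X ^ 2 + X) ∧
      ∀ k : ℕ, γ k = h.eval ((k : ℝ) ^ 2 + k) := by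
  obtain ⟨a, b, hab⟩ := decomp_s9 (p.natDegree + 1) p (Nat.lt_succ_self _)
  suffices hb : b = 0 by
    have hpa : p = a.comp (X ^ 2 + X) := by rw [hab, hb]; simp
    refine ⟨a, hpa, fun k => ?_⟩
    rw [hp, hpa]; simp [eval_comp]
  by_contra hb
  obtain ⟨T, hT⟩ := exists_legendre_op γ
  have hγ : γ = fun k : ℕ => p.eval (k : ℝ) := funext hp
  have hTQ : ∀ N, T (testQ N (fun _ => 1)) = testQ N γ := by
    intro N
    simp only [testQ, map_sum, map_smul, hT, smul_smul, mul_one]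
  have hspl : ∀ N, (taylor 1 (testQ N (fun k => p.eval (k : ℝ)))).Splits := by
    intro N
    have := hMS T hT _ (hyperbolic_testQ N)
    rw [hTQ, hγ] at this
    exact this.splits.taylor 1
  have hb4 : (C 4 * X + C 1) * b ≠ 0 := by
    refine mul_ne_zero ?_ hb
    intro h
    have := congrArg (eval 0) h
    simp at this
  obtain ⟨R, hR, hlim⟩ := exists_R ((C 4 * X + C 1) * b)
  have hR0 : R ≠ 0 := by
    intro h0
    rw [h0, degree_zero] at hR
    exact hb4 (degree_eq_bot.1 hR.symm)
  have hU : ∀ j : ℕ, Tendsto (fun N => (j.factorial : ℝ) *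
      (taylor 1 (testQ N (fun k => p.eval (k : ℝ)))).coeff j) atTop
      (𝓝 (eLim j * R.eval (j : ℝ) / (2 ^ j * (j.factorial : ℝ)))) := by
    intro j
    have := ((tendsto_wsum_odd a j).add (hlim j)).div_const (2 ^ j * (j.factorial : ℝ))
    rw [zero_add] at this
    refine this.congr fun N => ?_
    have hj : (j.factorial : ℝ) ≠ 0 := by positivity
    rw [taylor_testQ, ← wsum_add]
    have : (fun k : ℝ => (2 * k + 1) * (eval k p * ePr j (k ^ 2 + k))) =
      fun k => (2 * k + 1) * (eval (k ^ 2 + k) a * ePr j (k ^ 2 + k)) +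
        eval (k ^ 2 + k) ((C 4 * X + C 1) * b) * ePr j (k ^ 2 + k) := by
      funext k
      rw [hab]
      simp [eval_comp]; ring
    rw [this]
    field_simp
  refine no_R hR0 fun j => ?_
  have hle := le_of_tendsto_of_tendsto' ((hU j).mul (hU (j + 2))) ((hU (j + 1)).pow 2)
    (fun N => newton_coeff (hspl N) j)
  have hj : (0 : ℝ) < j.factorial := by positivity
  have hE : 0 < eLim j ^ 2 := by have := eLim_ne_zero j; positivity
  rw [show eLim (j + 2) = eLim (j + 1 + 1) from rfl, eLim, eLim, Nat.factorial_succ (j + 1),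
    Nat.factorial_succ j] at hle
  push_cast at hle
  set c : ℝ := eLim j ^ 2 * (2 * j + 1) / (16 * (2 ^ j * (j.factorial : ℝ)) ^ 2) with hc
  have hcpos : 0 < c := by positivity
  refine le_of_mul_le_mul_left (?_ : c * _ ≤ c * _) hcpos
  refine le_trans (le_of_eq ?_) (hle.trans (le_of_eq ?_))
  · rw [hc]; field_simp; ring
  · rw [hc]; field_simp; ring
end
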